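/- arXiv:1803.10564 — 8 statements merged into one kernel-verified Lean document; each statement's English description precedes it below -/
import Mathlib

section
/- Let p be an odd prime and let G be a subgroup of the multiplicative group Qp^×. Then there exist an element T ∈ G and a divisor s of p−1 such that, setting D := {g ∈ G : v_p(g) = 0}, every element g ∈ G can be written as g = T^n · d with n ∈ ℤ and d ∈ D, and the set D^s := {d^s : d ∈ D} is either the trivial group {1} or is dense in 1 + p^m·Zp for some integer m ≥ 1. -/
namespace PadicInt

variable {p : ℕ} [Fact p.Prime]

theorem exists_nat_prime_dvd_sub (x : ℤ_[p]) : ∃ n : ℕ, (p : ℤ_[p]) ∣ x - n := by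
  obtain ⟨n, -, hn⟩ := exists_mem_range (p := p) x
  rw [maximalIdeal_eq_span_p, Ideal.mem_span_singleton] at hn
  exact ⟨n, hn⟩

theorem isUnit_iff_not_prime_dvd (x : ℤ_[p]) : IsUnit x ↔ ¬ (p : ℤ_[p]) ∣ x := by
  rw [← norm_lt_one_iff_dvd, ← not_isUnit_iff, not_not]

theorem prime_dvd_pow_sub_one_sub_one {x : ℤ_[p]} (hx : IsUnit x) :
    (p : ℤ_[p]) ∣ x ^ (p - 1) - 1 := by
  rw [← Ideal.mem_span_singleton, ← maximalIdeal_eq_span_p, ← ker_toZMod, RingHom.mem_ker]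
  simp [ZMod.pow_card_sub_one_eq_one (hx.map toZMod).ne_zero]

/-- For odd `p`, the powers of an element of exact level `m ≥ 1` are dense in the principal units
of level `m`. -/
theorem exists_pow_dvd_sub_pow (hp : p ≠ 2) {m : ℕ} (hm : 1 ≤ m) {a : ℤ_[p]}
    (ha : emultiplicity (p : ℤ_[p]) (a - 1) = m) {y : ℤ_[p]} (hy : (p : ℤ_[p]) ^ m ∣ y - 1)
    (k : ℕ) : ∃ n : ℕ, (p : ℤ_[p]) ^ (m + k) ∣ y - a ^ n := by
  have hpodd : Odd p := (Fact.out : p.Prime).odd_of_ne_two hp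
  have hp0 : (p : ℤ_[p]) ∣ a - 1 :=
    (dvd_pow_self _ (by omega)).trans (pow_dvd_of_le_emultiplicity ha.ge)
  have hpa : ¬ (p : ℤ_[p]) ∣ a := fun h => prime_p.not_dvd_one (by simpa using dvd_sub h hp0)
  induction k with
  | zero => exact ⟨0, by simpa using hy⟩
  | succ k ih =>
    obtain ⟨n, z, hz⟩ := ih
    have hmul := emultiplicity_pow_prime_pow_sub_pow_prime_pow (y := (1 : ℤ_[p]))
      prime_p hpodd hp0 hpa k
    rw [one_pow, ha, ← Nat.cast_add, emultiplicity_eq_coe] at hmul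
    obtain ⟨⟨u, hu⟩, hndvd⟩ := hmul
    have hunit : IsUnit (a ^ n * u) := by
      refine ((isUnit_iff_not_prime_dvd a).2 hpa).pow n |>.mul ?_
      rw [isUnit_iff_not_prime_dvd]
      exact fun h => hndvd (by rw [hu, pow_succ]; exact mul_dvd_mul_left _ h)
    obtain ⟨w, hw⟩ := hunit.exists_right_inv
    obtain ⟨j, c, hj⟩ := exists_nat_prime_dvd_sub (w * z)
    obtain ⟨e, he⟩ := sq_dvd_add_pow_sub_sub (a ^ p ^ k - 1) 1 j
    obtain ⟨q, hq⟩ : (p : ℤ_[p]) ^ (m + k + 1) ∣ (a ^ p ^ k - 1) ^ 2 := by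
      rw [hu, mul_pow, ← pow_mul]
      exact (pow_dvd_pow _ (by omega)).mul_right _
    refine ⟨n + p ^ k * j, a ^ n * u * c - a ^ n * q * e, ?_⟩
    rw [pow_add a, pow_mul, ← add_assoc]
    simp only [one_pow, one_mul, add_sub_cancel] at he
    rw [hq] at he
    rw [pow_succ] at he ⊢
    linear_combination hz - a ^ n * he - a ^ n * j * hu - (p : ℤ_[p]) ^ (m + k) * z * hw
      + (p : ℤ_[p]) ^ (m + k) * a ^ n * u * hj

/-- For odd `p`, a nontrivial submonoid of the principal units of `ℤ_[p]` is dense in the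
principal units of some level. -/
theorem exists_level_of_submonoid (hp : p ≠ 2) (X : Submonoid ℤ_[p])
    (hX : ∀ x ∈ X, (p : ℤ_[p]) ∣ x - 1) (hne : ∃ x ∈ X, x ≠ 1) :
    ∃ m : ℕ, 1 ≤ m ∧ (∀ x ∈ X, (p : ℤ_[p]) ^ m ∣ x - 1) ∧
      ∀ y : ℤ_[p], (p : ℤ_[p]) ^ m ∣ y - 1 → ∀ k : ℕ, ∃ x ∈ X, (p : ℤ_[p]) ^ k ∣ y - x := by
  classical
  have hfin {x : ℤ_[p]} (hx : x ≠ 1) : FiniteMultiplicity (p : ℤ_[p]) (x - 1) :=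
    FiniteMultiplicity.of_prime_left prime_p (sub_ne_zero.2 hx)
  have hex : ∃ m : ℕ, ∃ x ∈ X, emultiplicity (p : ℤ_[p]) (x - 1) = m := by
    obtain ⟨x, hx, hx1⟩ := hne
    exact ⟨_, x, hx, (hfin hx1).emultiplicity_eq_multiplicity⟩
  obtain ⟨a, haX, ha⟩ := Nat.find_spec hex
  have hm : 1 ≤ Nat.find hex := by
    have := le_emultiplicity_of_pow_dvd (k := 1) (by simpa using hX a haX)
    rw [ha] at this
    exact_mod_cast this
  refine ⟨Nat.find hex, hm, fun x hx => ?_, fun y hy k => ?_⟩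
  · by_cases hx1 : x = 1
    · simp [hx1]
    · have hfx := (hfin hx1).emultiplicity_eq_multiplicity
      refine pow_dvd_of_le_emultiplicity ?_
      rw [hfx]
      exact_mod_cast Nat.find_min' hex ⟨x, hx, hfx⟩
  · obtain ⟨n, hn⟩ := exists_pow_dvd_sub_pow hp hm ha hy k
    exact ⟨a ^ n, pow_mem haX n, (pow_dvd_pow _ (by omega)).trans hn⟩

theorem norm_coe_le_pow_iff_dvd (x : ℤ_[p]) (n : ℕ) :
    ‖(x : ℚ_[p])‖ ≤ (p : ℝ) ^ (-(n : ℤ)) ↔ (p : ℤ_[p]) ^ n ∣ x := by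
  rw [← Ideal.mem_span_singleton, ← norm_le_pow_iff_mem_span_pow, norm_def]

end PadicInt

namespace Padic

variable {p : ℕ} [Fact p.Prime]

theorem norm_eq_one_of_valuation_eq_zero {x : ℚ_[p]} (hx : x ≠ 0) (h : x.valuation = 0) :
    ‖x‖ = 1 := by
  simp [norm_eq_zpow_neg_valuation hx, h]

theorem exists_zpow_mul_valuation_eq_zero (G : Subgroup ℚ_[p]ˣ) :
    ∃ T ∈ G, ∀ g ∈ G, ∃ n : ℤ, ∃ d ∈ G, (d : ℚ_[p]).valuation = 0 ∧ g = T ^ n * d := by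
  let v : Additive ℚ_[p]ˣ →+ ℤ :=
    { toFun := fun g => ((g.toMul : ℚ_[p]ˣ) : ℚ_[p]).valuation
      map_zero' := by simp
      map_add' := fun x y => by simp [valuation_mul] }
  obtain ⟨a, ha⟩ := Int.subgroup_cyclic (G.toAddSubgroup.map v)
  obtain ⟨T, hT, hTa⟩ : a ∈ G.toAddSubgroup.map v := ha ▸ AddSubgroup.mem_closure_singleton_self a
  refine ⟨T.toMul, hT, fun g hg => ?_⟩
  have hgv : v (.ofMul g) ∈ AddSubgroup.closure {a} := ha ▸ ⟨_, hg, rfl⟩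
  obtain ⟨n, hn⟩ := AddSubgroup.mem_closure_singleton.1 hgv
  refine ⟨n, (T.toMul ^ n)⁻¹ * g, G.mul_mem (G.inv_mem (G.zpow_mem hT n)) hg, ?_, by simp⟩
  change v (-(n • T) + .ofMul g) = 0
  rw [map_add, map_neg, map_zsmul, hTa, hn]
  simp

end Padic


/-- For an odd prime `p` and a subgroup `G` of `ℚ_[p]ˣ`, there exist `T ∈ G` and a
divisor `s` of `p - 1` such that, with `D = {g ∈ G : v_p g = 0}`, every `g ∈ G` factors as
`T ^ n * d` with `n : ℤ` and `d ∈ D`, and the set `D ^ s = {d ^ s : d ∈ D}` is either the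
trivial group `{1}` or dense in `1 + p ^ m ℤ_p` for some `m ≥ 1`. -/
theorem stmt_0 (p : ℕ) [Fact p.Prime] (hp : p ≠ 2) (G : Subgroup ℚ_[p]ˣ) :
    ∃ T ∈ G, ∃ s : ℕ, s ∣ p - 1 ∧
      (∀ g ∈ G, ∃ n : ℤ, ∃ d ∈ G, ((d : ℚ_[p])).valuation = 0 ∧ g = T ^ n * d) ∧
      ({x : ℚ_[p] | ∃ d ∈ G, ((d : ℚ_[p])).valuation = 0 ∧ x = (d : ℚ_[p]) ^ s} = {1} ∨
        ∃ m : ℕ, 1 ≤ m ∧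
          closure {x : ℚ_[p] | ∃ d ∈ G, ((d : ℚ_[p])).valuation = 0 ∧ x = (d : ℚ_[p]) ^ s}
            = {x : ℚ_[p] | ‖x - 1‖ ≤ (p : ℝ) ^ (-(m : ℤ))}) := by
  obtain ⟨T, hT, hfac⟩ := Padic.exists_zpow_mul_valuation_eq_zero G
  refine ⟨T, hT, p - 1, dvd_rfl, hfac, ?_⟩
  set S : Set ℚ_[p] :=
    {x | ∃ d ∈ G, ((d : ℚ_[p])).valuation = 0 ∧ x = (d : ℚ_[p]) ^ (p - 1)}
  let X : Submonoid ℤ_[p] :=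
    { carrier := {x | (x : ℚ_[p]) ∈ S}
      one_mem' := ⟨1, G.one_mem, by simp, by simp⟩
      mul_mem' := by
        rintro x y ⟨d, hd, hdv, hx⟩ ⟨e, he, hev, hy⟩
        refine ⟨d * e, G.mul_mem hd he, ?_, ?_⟩
        · simp [Padic.valuation_mul, hdv, hev]
        · simp [hx, hy, mul_pow] }
  have hunit : ∀ x ∈ S, ∃ u : ℤ_[p], IsUnit u ∧ x = ((u ^ (p - 1) : ℤ_[p]) : ℚ_[p]) := by
    rintro x ⟨d, -, hdv, hx⟩
    have hd := Padic.norm_eq_one_of_valuation_eq_zero d.ne_zero hdv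
    let u : ℤ_[p] := ⟨d, hd.le⟩
    exact ⟨u, PadicInt.isUnit_iff.2 hd, hx.trans (PadicInt.coe_pow u (p - 1)).symm⟩
  have hX : ∀ x ∈ X, (p : ℤ_[p]) ∣ x - 1 := by
    intro x hx
    obtain ⟨u, hu, hxu⟩ := hunit x hx
    rw [Subtype.coe_injective hxu]
    exact PadicInt.prime_dvd_pow_sub_one_sub_one hu
  by_cases hne : ∃ x ∈ X, x ≠ 1
  · right
    obtain ⟨m, hm, hsub, hdense⟩ := PadicInt.exists_level_of_submonoid hp X hX hne
    refine ⟨m, hm, Set.Subset.antisymm (closure_minimal ?_ ?_) ?_⟩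
    · intro x hx
      obtain ⟨u, -, rfl⟩ := hunit x hx
      simpa using (PadicInt.norm_coe_le_pow_iff_dvd (u ^ (p - 1) - 1) m).2 (hsub _ hx)
    · exact isClosed_le (by fun_prop) continuous_const
    · intro y hy
      have hp1 : (1 : ℝ) < p := mod_cast (Fact.out : p.Prime).one_lt
      have hy1 : ‖y‖ ≤ 1 := by
        have h1 : ‖y - 1‖ ≤ 1 :=
          le_trans hy (zpow_le_one_of_nonpos₀ hp1.le (by simp))
        simpa using (Padic.nonarchimedean (y - 1) 1).trans (max_le h1 (by simp))
      obtain ⟨y, rfl⟩ : ∃ z : ℤ_[p], (z : ℚ_[p]) = y := ⟨⟨y, hy1⟩, rfl⟩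
      have hdvd : (p : ℤ_[p]) ^ m ∣ y - 1 := by
        rw [← PadicInt.norm_coe_le_pow_iff_dvd]
        simpa using hy
      refine Metric.mem_closure_iff.2 fun ε hε => ?_
      obtain ⟨k, hk⟩ := PadicInt.exists_pow_neg_lt p hε
      obtain ⟨x, hx, hxk⟩ := hdense y hdvd k
      refine ⟨x, hx, lt_of_le_of_lt ?_ hk⟩
      rw [dist_eq_norm, ← PadicInt.coe_sub]
      exact (PadicInt.norm_coe_le_pow_iff_dvd _ _).2 hxk
  · left
    push Not at hne
    refine Set.eq_singleton_iff_unique_mem.2 ⟨X.one_mem, fun x hx => ?_⟩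
    obtain ⟨u, -, rfl⟩ := hunit x hx
    rw [hne _ hx, PadicInt.coe_one]
end

section
/- Let G' be a nonzero additive subgroup of Zp and let n := min{v_p(g) : g ∈ G', g ≠ 0} (this minimum exists since valuations of nonzero p-adic integers are natural numbers). Then G' is dense in p^n·Zp = {x ∈ Zp : v_p(x) ≥ n}; equivalently, the topological closure of G' in Zp equals p^n·Zp. In particular, for g ∈ Zp with v_p(g) = n, the set of integer multiples of g is dense in p^n·Zp. -/
theorem PadicInt.dvd_of_norm_le {p : ℕ} [Fact p.Prime] {g x : ℤ_[p]} (hg : g ≠ 0)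
    (h : ‖x‖ ≤ ‖g‖) : g ∣ x := by
  have hg' : (g : ℚ_[p]) ≠ 0 := fun h0 => hg (Subtype.ext h0)
  have hq : ‖(x / g : ℚ_[p])‖ ≤ 1 := by
    rw [norm_div]
    exact div_le_one_of_le₀ h (norm_nonneg _)
  refine ⟨⟨x / g, hq⟩, Subtype.ext ?_⟩
  change (x : ℚ_[p]) = g * (x / g)
  field_simp

theorem PadicInt.mem_closure_range_zsmul {p : ℕ} [Fact p.Prime] {g x : ℤ_[p]} (hg : g ≠ 0)
    (h : ‖x‖ ≤ ‖g‖) : x ∈ closure (Set.range fun k : ℤ => k • g) := by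
  obtain ⟨y, rfl⟩ := dvd_of_norm_le hg h
  refine map_mem_closure (f := fun y => g * y) (by fun_prop)
    (PadicInt.denseRange_intCast y) ?_
  rintro _ ⟨k, rfl⟩
  exact ⟨k, by simp [mul_comm]⟩

theorem PadicInt.closure_addSubgroup_eq {p : ℕ} [Fact p.Prime] (H : AddSubgroup ℤ_[p])
    {g : ℤ_[p]} (hg : g ≠ 0) (hgH : g ∈ H) (hmax : ∀ x ∈ H, ‖x‖ ≤ ‖g‖) :
    closure (H : Set ℤ_[p]) = {x : ℤ_[p] | ‖x‖ ≤ ‖g‖} := by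
  refine (closure_minimal hmax (isClosed_le continuous_norm continuous_const)).antisymm
    fun x hx => closure_mono ?_ (mem_closure_range_zsmul hg hx)
  rintro _ ⟨k, rfl⟩
  exact H.zsmul_mem hgH k


/-- a nonzero additive subgroup `G'` of `ℤ_p` whose nonzero elements have minimal
valuation `n` (equivalently maximal norm `p ^ (-n)`) is dense in `p ^ n ℤ_p`; in particular the
integer multiples of any `g` with `v_p g = n` are dense in `p ^ n ℤ_p`. -/
theorem stmt_3 (p : ℕ) [Fact p.Prime] (G' : AddSubgroup ℤ_[p]) (n : ℕ)
    (hmem : ∃ g ∈ G', g ≠ 0 ∧ ‖g‖ = (p : ℝ) ^ (-(n : ℤ)))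
    (hmin : ∀ g ∈ G', ‖g‖ ≤ (p : ℝ) ^ (-(n : ℤ))) :
    closure (G' : Set ℤ_[p]) = {x : ℤ_[p] | ‖x‖ ≤ (p : ℝ) ^ (-(n : ℤ))} ∧
    ∀ g : ℤ_[p], ‖g‖ = (p : ℝ) ^ (-(n : ℤ)) →
      closure (Set.range fun k : ℤ => k • g) = {x : ℤ_[p] | ‖x‖ ≤ (p : ℝ) ^ (-(n : ℤ))} := by
  obtain ⟨g, hgG, hg0, hg⟩ := hmem
  refine ⟨hg ▸ PadicInt.closure_addSubgroup_eq G' hg0 hgG (hg ▸ hmin), fun a ha => ?_⟩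
  have ha0 : a ≠ 0 := norm_ne_zero_iff.mp (by rw [ha, ← hg]; exact norm_ne_zero_iff.mpr hg0)
  rw [← ha]
  refine (closure_minimal ?_ (isClosed_le continuous_norm continuous_const)).antisymm
    fun x hx => PadicInt.mem_closure_range_zsmul ha0 hx
  rintro _ ⟨k, rfl⟩
  simpa using mul_le_of_le_one_left (norm_nonneg a) (PadicInt.norm_le_one (k : ℤ_[p]))
end

section
/- Let p be an odd prime and let H be a nontrivial subgroup of the multiplicative group 1 + p·Zp. Let n := min{v_p(h−1) : h ∈ H, h ≠ 1}. Then H is dense in 1 + p^n·Zp; equivalently, the topological closure of H in Zp equals 1 + p^n·Zp. -/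
/-- Lifting the exponent in `ℤ_[p]`: raising to the power `p ^ k` adds exactly `k` to the valuation
of `h - 1`. -/
lemma PadicInt.exists_isUnit_pow_prime_pow_eq {p : ℕ} [Fact p.Prime] (hp : p ≠ 2) {h u : ℤ_[p]}
    {n : ℕ} (hn : n ≠ 0) (hu : IsUnit u) (hh : h = 1 + (p : ℤ_[p]) ^ n * u) (k : ℕ) :
    ∃ v : ℤ_[p], IsUnit v ∧ h ^ p ^ k = 1 + (p : ℤ_[p]) ^ (n + k) * v := by
  have hpp : Prime (p : ℤ_[p]) := PadicInt.prime_p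
  have hsub : h - 1 = (p : ℤ_[p]) ^ n * u := by rw [hh]; ring
  have hdvd : (p : ℤ_[p]) ∣ h - 1 := hsub ▸ (dvd_pow_self _ hn).mul_right u
  have hndvd : ¬ (p : ℤ_[p]) ∣ h := fun hd =>
    hpp.not_dvd_one <| by simpa using dvd_sub hd hdvd
  have hmul : emultiplicity (p : ℤ_[p]) (h - 1) = n := by
    rw [hsub, emultiplicity_mul hpp, emultiplicity_pow_self_of_prime hpp,
      emultiplicity_eq_zero.2 fun hd => hpp.not_isUnit (isUnit_of_dvd_unit hd hu), add_zero]
  have hlift := emultiplicity_pow_prime_pow_sub_pow_prime_pow hpp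
    ((Fact.out : p.Prime).odd_of_ne_two hp) hdvd hndvd k
  rw [one_pow, hmul, ← Nat.cast_add] at hlift
  obtain ⟨⟨v, hv⟩, hnot⟩ := emultiplicity_eq_coe.1 hlift
  refine ⟨v, ?_, by rw [← hv]; ring⟩
  by_contra hvu
  rw [← mem_nonunits_iff, PadicInt.mem_nonunits, PadicInt.norm_lt_one_iff_dvd] at hvu
  exact hnot <| hv ▸ pow_succ (p : ℤ_[p]) (n + k) ▸ mul_dvd_mul_left _ hvu

/-- A subgroup of `ℤ_[p]ˣ` containing an element of exact level `n ≥ 1` meets every residue class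
contained in `1 + p ^ n ℤ_[p]`. -/
lemma PadicInt.exists_mem_subgroup_pow_dvd_sub {p : ℕ} [Fact p.Prime] (hp : p ≠ 2)
    {H : Subgroup ℤ_[p]ˣ} {h : ℤ_[p]ˣ} (hH : h ∈ H) {u : ℤ_[p]} {n : ℕ} (hn : n ≠ 0)
    (hu : IsUnit u) (hh : (h : ℤ_[p]) = 1 + (p : ℤ_[p]) ^ n * u) {x : ℤ_[p]}
    (hx : (p : ℤ_[p]) ^ n ∣ x - 1) (k : ℕ) :
    ∃ g ∈ H, (p : ℤ_[p]) ^ (n + k) ∣ (g : ℤ_[p]) - x := by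
  induction k with
  | zero => exact ⟨1, H.one_mem, by simpa using (dvd_sub_comm.1 hx)⟩
  | succ k ih =>
    obtain ⟨g, hg, c, hc⟩ := ih
    obtain ⟨v, hv, hvh⟩ := PadicInt.exists_isUnit_pow_prime_pow_eq hp hn hu hh k
    obtain ⟨w, hw⟩ := (g.isUnit.mul hv).exists_right_inv
    obtain ⟨m, -, hm⟩ := PadicInt.exists_mem_range (-c * w)
    rw [PadicInt.maximalIdeal_eq_span_p, Ideal.mem_span_singleton] at hm
    obtain ⟨d, hd⟩ := hm
    obtain ⟨e, he⟩ := sq_dvd_add_pow_sub_sub ((p : ℤ_[p]) ^ (n + k) * v) 1 m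
    obtain ⟨j, rfl⟩ := Nat.exists_eq_succ_of_ne_zero hn
    refine ⟨g * (h ^ p ^ k) ^ m, H.mul_mem hg (H.pow_mem (H.pow_mem hH _) _),
      g * (p : ℤ_[p]) ^ (j + k) * v ^ 2 * e - g * v * d, ?_⟩
    push_cast
    rw [hvh]
    simp only [one_pow, one_mul] at he
    simp only [Nat.succ_eq_add_one] at *
    linear_combination (g : ℤ_[p]) * he + hc - (p : ℤ_[p]) ^ (j + 1 + k) * g * v * hd
      - (p : ℤ_[p]) ^ (j + 1 + k) * c * hw

/-- for an odd prime `p`, a nontrivial subgroup `H` of the multiplicative group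
`1 + p ℤ_p` with `n = min {v_p (h - 1) : h ∈ H, h ≠ 1}` is dense in `1 + p ^ n ℤ_p`. -/
theorem stmt_4 (p : ℕ) [Fact p.Prime] (hp : p ≠ 2) (H : Subgroup ℤ_[p]ˣ)
    (hH : ∀ h ∈ H, ‖((h : ℤ_[p])) - 1‖ ≤ (p : ℝ) ^ (-(1 : ℤ)))
    (n : ℕ)
    (hmem : ∃ h ∈ H, h ≠ 1 ∧ ‖((h : ℤ_[p])) - 1‖ = (p : ℝ) ^ (-(n : ℤ)))
    (hmin : ∀ h ∈ H, h ≠ 1 → ‖((h : ℤ_[p])) - 1‖ ≤ (p : ℝ) ^ (-(n : ℤ))) :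
    closure {x : ℤ_[p] | ∃ h ∈ H, x = (h : ℤ_[p])}
      = {x : ℤ_[p] | ‖x - 1‖ ≤ (p : ℝ) ^ (-(n : ℤ))} := by
  obtain ⟨h, hhH, hh1, hhn⟩ := hmem
  have hp1 : (1 : ℝ) < p := mod_cast (Fact.out : p.Prime).one_lt
  have hn : n ≠ 0 := by
    rintro rfl
    have := hH h hhH
    rw [hhn, zpow_le_zpow_iff_right₀ hp1] at this
    simp at this
  have hne : (h : ℤ_[p]) - 1 ≠ 0 := sub_ne_zero.2 fun hc => hh1 (Units.ext hc)
  have hval : ((h : ℤ_[p]) - 1).valuation = n := by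
    rw [PadicInt.norm_eq_zpow_neg_valuation hne] at hhn
    have := zpow_right_injective₀ (by positivity) hp1.ne' hhn
    omega
  have hspec := PadicInt.unitCoeff_spec hne
  rw [hval] at hspec
  apply Set.Subset.antisymm
  · refine closure_minimal ?_ (isClosed_le (by fun_prop) continuous_const)
    rintro _ ⟨g, hg, rfl⟩
    rcases eq_or_ne g 1 with rfl | hg1
    · simp
    · exact hmin g hg hg1
  · intro x hx
    rw [Set.mem_ofPred_eq, PadicInt.norm_le_pow_iff_mem_span_pow, Ideal.mem_span_singleton] at hx
    refine Metric.mem_closure_iff.2 fun ε hε => ?_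
    obtain ⟨k, hk⟩ := PadicInt.exists_pow_neg_lt p hε
    obtain ⟨g, hg, hgx⟩ := PadicInt.exists_mem_subgroup_pow_dvd_sub hp hhH hn
      (PadicInt.unitCoeff hne).isUnit (by linear_combination hspec) hx k
    refine ⟨g, ⟨g, hg, rfl⟩, lt_of_le_of_lt ?_ hk⟩
    rw [dist_comm, dist_eq_norm, PadicInt.norm_le_pow_iff_mem_span_pow, Ideal.mem_span_singleton]
    exact (pow_dvd_pow _ (Nat.le_add_left k n)).trans hgx
end

section
/- Let p and q be distinct primes, let t ≥ 1, and let x_1, …, x_{t−1} ∈ Zp be algebraically independent over ℚ (viewing them as elements of Qp, which is a ℚ-algebra). Let Z(p,q) := {a/b ∈ ℚ : a, b ∈ ℤ, p ∤ b, q ∤ b} ⊆ Zp, and let G₁ := ℤ + x_1·Z(p,q) + … + x_{t−1}·Z(p,q), an additive subgroup of Zp. Then: (i) for every prime q' with q' ≠ p and q' ≠ q, the quotient G₁/q'G₁ has exactly q' elements; (ii) G₁/pG₁ has exactly p^t elements; (iii) G₁/qG₁ has exactly q^t elements. -/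
/-- The set `Z(p,q)` of rationals `a/b` with `b` prime to both `p` and `q`, viewed inside
`ℤ_p`. -/
def Zpq (p : ℕ) [Fact p.Prime] (q : ℕ) : Set ℤ_[p] :=
  {z | ∃ a b : ℤ, ¬ (p : ℤ) ∣ b ∧ ¬ (q : ℤ) ∣ b ∧ (b : ℤ_[p]) * z = (a : ℤ_[p])}

/-- The additive subgroup `G₁ = ℤ + x₁ Z(p,q) + ⋯ + x_{t-1} Z(p,q)` of `ℤ_p`. -/
noncomputable def G1 (p : ℕ) [Fact p.Prime] (q t : ℕ) (x : Fin (t - 1) → ℤ_[p]) : AddSubgroup ℤ_[p] :=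
  AddSubgroup.closure (insert (1 : ℤ_[p]) {z | ∃ i : Fin (t - 1), ∃ c ∈ Zpq p q, z = x i * c})

/-- The subgroup `n • A = {n • a : a ∈ A}` of an additive commutative group. -/
def smulRange (n : ℕ) (A : Type*) [AddCommGroup A] : AddSubgroup A :=
  AddMonoidHom.range
    { toFun := fun a => n • a
      map_zero' := smul_zero n
      map_add' := fun a b => smul_add n a b }

/-- The additive group of rationals whose denominator is divisible by neither `p` nor `q`. -/
def ratPrimeTo (p q : ℕ) (hp : p.Prime) (hq : q.Prime) : AddSubgroup ℚ where
  carrier := {r | ¬ p ∣ r.den ∧ ¬ q ∣ r.den}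
  zero_mem' := by simp [hp.ne_one, hq.ne_one]
  add_mem' := by
    rintro a b ⟨ha, ha'⟩ ⟨hb, hb'⟩
    refine ⟨fun h => ?_, fun h => ?_⟩
    · exact (hp.dvd_mul.1 (h.trans (Rat.add_den_dvd a b))).elim ha hb
    · exact (hq.dvd_mul.1 (h.trans (Rat.add_den_dvd a b))).elim ha' hb'
  neg_mem' := by
    rintro a ⟨ha, ha'⟩
    exact ⟨by simpa using ha, by simpa using ha'⟩

lemma mem_ratPrimeTo {p q : ℕ} {hp : p.Prime} {hq : q.Prime} {r : ℚ} :
    r ∈ ratPrimeTo p q hp hq ↔ ¬ p ∣ r.den ∧ ¬ q ∣ r.den := Iff.rfl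

lemma div_mem_ratPrimeTo {p q : ℕ} {hp : p.Prime} {hq : q.Prime} {a b : ℤ}
    (hpb : ¬ (p : ℤ) ∣ b) (hqb : ¬ (q : ℤ) ∣ b) : (a / b : ℚ) ∈ ratPrimeTo p q hp hq := by
  have h : (((a / b : ℚ)).den : ℤ) ∣ b := by
    simpa [Rat.divInt_eq_div] using Rat.den_dvd a b
  exact ⟨fun hd => hpb ((Int.natCast_dvd_natCast.2 hd).trans h),
    fun hd => hqb ((Int.natCast_dvd_natCast.2 hd).trans h)⟩

lemma den_cast_zmod_ne_zero {p q n : ℕ} {hp : p.Prime} {hq : q.Prime} (hn : n = p ∨ n = q)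
    (r : ratPrimeTo p q hp hq) : ((r : ℚ).den : ZMod n) ≠ 0 := by
  rw [Ne, ZMod.natCast_eq_zero_iff]
  rcases hn with rfl | rfl
  exacts [r.2.1, r.2.2]

/-- Reduction modulo a prime `n` that divides no denominator in `ratPrimeTo p q`. -/
def ratPrimeToReduce (p q n : ℕ) (hp : p.Prime) (hq : q.Prime) [Fact n.Prime]
    (hn : n = p ∨ n = q) : ratPrimeTo p q hp hq →+ ZMod n where
  toFun r := ((r : ℚ) : ZMod n)
  map_zero' := by simp
  map_add' a b :=
    Rat.cast_add_of_ne_zero (den_cast_zmod_ne_zero hn a) (den_cast_zmod_ne_zero hn b)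

lemma ratPrimeToReduce_eq_zero {p q n : ℕ} {hp : p.Prime} {hq : q.Prime} [Fact n.Prime]
    (hn : n = p ∨ n = q) (r : ratPrimeTo p q hp hq) :
    ratPrimeToReduce p q n hp hq hn r = 0 ↔ ∃ s : ratPrimeTo p q hp hq, n • s = r := by
  constructor
  · intro h
    have h' : ((r : ℚ) : ZMod n) = 0 := h
    rw [Rat.cast_def, div_eq_zero_iff, or_iff_left (den_cast_zmod_ne_zero hn r),
      ZMod.intCast_zmod_eq_zero_iff_dvd] at h'
    obtain ⟨k, hk⟩ := h'
    refine ⟨⟨k / ((r : ℚ).den : ℤ), div_mem_ratPrimeTo ?_ ?_⟩, ?_⟩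
    · exact_mod_cast r.2.1
    · exact_mod_cast r.2.2
    · ext
      rw [AddSubgroup.coe_nsmul]
      simp only [nsmul_eq_mul, Int.cast_natCast]
      conv_rhs => rw [← Rat.num_div_den (r : ℚ), hk]
      push_cast
      ring
  · rintro ⟨s, rfl⟩
    rw [map_nsmul, nsmul_eq_mul, CharP.cast_eq_zero, zero_mul]

lemma ratPrimeToReduce_surjective {p q n : ℕ} {hp : p.Prime} {hq : q.Prime} [Fact n.Prime]
    (hn : n = p ∨ n = q) : Function.Surjective (ratPrimeToReduce p q n hp hq hn) := by
  intro z
  obtain ⟨m, rfl⟩ := ZMod.intCast_surjective z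
  refine ⟨⟨m, ?_⟩, ?_⟩
  · simp [mem_ratPrimeTo, hp.ne_one, hq.ne_one]
  · simp [ratPrimeToReduce]

lemma ratPrimeTo_exists_nsmul_eq {p q n : ℕ} {hp : p.Prime} {hq : q.Prime} (hn : n.Prime)
    (hnp : n ≠ p) (hnq : n ≠ q) (r : ratPrimeTo p q hp hq) :
    ∃ s : ratPrimeTo p q hp hq, n • s = r := by
  have hn0 : (n : ℚ) ≠ 0 := Nat.cast_ne_zero.2 hn.ne_zero
  refine ⟨⟨(r : ℚ).num / ((n * (r : ℚ).den : ℕ) : ℤ), div_mem_ratPrimeTo ?_ ?_⟩, ?_⟩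
  · rw [Int.natCast_dvd_natCast, hp.dvd_mul, Nat.prime_dvd_prime_iff_eq hp hn]
    exact not_or_intro hnp.symm r.2.1
  · rw [Int.natCast_dvd_natCast, hq.dvd_mul, Nat.prime_dvd_prime_iff_eq hq hn]
    exact not_or_intro hnq.symm r.2.2
  · ext
    rw [AddSubgroup.coe_nsmul]
    simp only [nsmul_eq_mul, Int.cast_natCast]
    conv_rhs => rw [← Rat.num_div_den (r : ℚ)]
    push_cast
    field_simp

lemma mem_Zpq_iff {p : ℕ} [hp : Fact p.Prime] {q : ℕ} (hq : q.Prime) (z : ℤ_[p]) :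
    z ∈ Zpq p q ↔ ∃ r ∈ ratPrimeTo p q hp.out hq, (z : ℚ_[p]) = r := by
  constructor
  · rintro ⟨a, b, hpb, hqb, h⟩
    have hb : (b : ℚ_[p]) ≠ 0 := by
      rintro hb
      rw [Int.cast_eq_zero] at hb
      simp [hb] at hpb
    refine ⟨a / b, div_mem_ratPrimeTo hpb hqb, ?_⟩
    have h' := congrArg (fun y : ℤ_[p] => (y : ℚ_[p])) h
    push_cast at h' ⊢
    rw [eq_div_iff hb, mul_comm, h']
  · rintro ⟨r, hr, h⟩
    refine ⟨r.num, r.den, by exact_mod_cast hr.1, by exact_mod_cast hr.2, ?_⟩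
    have hd : (r.den : ℚ_[p]) ≠ 0 := Nat.cast_ne_zero.2 r.den_ne_zero
    apply PadicInt.ext
    push_cast
    rw [h, Rat.cast_def, mul_div_cancel₀ _ hd]

/-- The homomorphism `(m, r) ↦ m + ∑ᵢ xᵢ rᵢ` into `ℚ_p`. -/
noncomputable def affineCombination {p q k : ℕ} [hp : Fact p.Prime] (hq : q.Prime) (x : Fin k → ℤ_[p]) :
    ℤ × (Fin k → ratPrimeTo p q hp.out hq) →+ ℚ_[p] where
  toFun v := v.1 + ∑ i, (x i : ℚ_[p]) * ((v.2 i : ℚ) : ℚ_[p])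
  map_zero' := by simp
  map_add' v w := by
    simp only [Prod.fst_add, Prod.snd_add, Pi.add_apply, AddSubgroup.coe_add]
    push_cast
    simp only [mul_add, Finset.sum_add_distrib]
    ring

lemma affineCombination_injective {p q k : ℕ} [hp : Fact p.Prime] (hq : q.Prime)
    {x : Fin k → ℤ_[p]} (hx : AlgebraicIndependent ℚ fun i => ((x i : ℤ_[p]) : ℚ_[p])) :
    Function.Injective (affineCombination hq x) := by
  rw [injective_iff_map_eq_zero]
  rintro ⟨m, r⟩ h
  have h0 : (MvPolynomial.C (m : ℚ) +
      ∑ i, MvPolynomial.X i * MvPolynomial.C (r i : ℚ) : MvPolynomial (Fin k) ℚ) = 0 := by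
    apply (injective_iff_map_eq_zero _).1 (algebraicIndependent_iff_injective_aeval.1 hx)
    simpa [affineCombination] using h
  have hm : m = 0 := by
    simpa using congrArg (MvPolynomial.eval (0 : Fin k → ℚ)) h0
  subst hm
  refine Prod.ext rfl (funext fun i => Subtype.ext ?_)
  simpa [Pi.single_apply] using congrArg (MvPolynomial.eval (Pi.single i 1 : Fin k → ℚ)) h0

lemma range_affineCombination {p q t : ℕ} [hp : Fact p.Prime] (hq : q.Prime)
    (x : Fin (t - 1) → ℤ_[p]) :
    (affineCombination hq x).range =
      (G1 p q t x).map (PadicInt.Coe.ringHom (p := p)).toAddMonoidHom := by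
  apply le_antisymm
  · rintro _ ⟨⟨m, r⟩, rfl⟩
    let c (i : Fin (t - 1)) : ℤ_[p] := ⟨((r i : ℚ) : ℚ_[p]), Padic.norm_rat_le_one (r i).2.1⟩
    refine ⟨m + ∑ i, x i * c i, add_mem ?_ (sum_mem fun i _ => ?_), ?_⟩
    · rw [← zsmul_one]
      exact zsmul_mem (AddSubgroup.subset_closure (Set.mem_insert _ _)) m
    · refine AddSubgroup.subset_closure (Set.mem_insert_of_mem _ ⟨i, c i, ?_, rfl⟩)
      exact (mem_Zpq_iff hq _).2 ⟨r i, (r i).2, rfl⟩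
    · change PadicInt.Coe.ringHom (p := p) _ = _
      simp only [map_add, map_intCast, map_sum, map_mul]
      rfl
  · rw [AddSubgroup.map_le_iff_le_comap, G1, AddSubgroup.closure_le]
    rintro z (rfl | ⟨i, c, hc, rfl⟩)
    · exact ⟨(1, 0), by simp [affineCombination]⟩
    · obtain ⟨r, hr, h⟩ := (mem_Zpq_iff hq c).1 hc
      refine ⟨(0, Pi.single i ⟨r, hr⟩), ?_⟩
      have key (j : Fin (t - 1)) :
          (((Pi.single i ⟨r, hr⟩ : Fin (t - 1) → ratPrimeTo p q hp.out hq) j : ℚ) : ℚ_[p]) =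
            if j = i then (r : ℚ_[p]) else 0 := by
        by_cases hj : j = i
        · subst hj; simp
        · simp [hj]
      trans (x i : ℚ_[p]) * (c : ℚ_[p])
      · simp [affineCombination, key, h]
      · rfl

lemma card_quotient_smulRange {A B C : Type*} [AddCommGroup A] [AddCommGroup B] [AddCommGroup C]
    (n : ℕ) (e : A ≃+ B) (f : B →+ C) (hf : Function.Surjective f)
    (hker : ∀ b, f b = 0 ↔ ∃ b', n • b' = b) : Nat.card (A ⧸ smulRange n A) = Nat.card C := by
  have h : smulRange n A = (f.comp e.toAddMonoidHom).ker := by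
    ext a
    rw [AddMonoidHom.mem_ker]
    refine Iff.trans ?_ (hker (e a)).symm
    constructor
    · rintro ⟨a', rfl⟩
      exact ⟨e a', (map_nsmul e n a').symm⟩
    · rintro ⟨b, hb⟩
      refine ⟨e.symm b, e.injective ?_⟩
      simpa using hb
  rw [h]
  exact Nat.card_congr (QuotientAddGroup.quotientKerEquivOfSurjective _
    (by simpa using hf.comp e.surjective)).toEquiv

lemma intCast_zmod_eq_zero_iff_exists_nsmul (n : ℕ) (m : ℤ) :
    (m : ZMod n) = 0 ↔ ∃ l : ℤ, n • l = m := by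
  simp only [ZMod.intCast_zmod_eq_zero_iff_dvd, dvd_def, nsmul_eq_mul, eq_comm]

/-- for distinct primes `p, q` and `x₁, …, x_{t-1} ∈ ℤ_p` algebraically
independent over `ℚ`, the group `G₁ = ℤ + Σᵢ xᵢ Z(p,q)` satisfies `|G₁/q'G₁| = q'` for primes
`q' ∉ {p, q}`, `|G₁/pG₁| = p ^ t` and `|G₁/qG₁| = q ^ t`. -/
theorem stmt_5 (p q : ℕ) [Fact p.Prime] (hq : q.Prime) (hpq : p ≠ q)
    (t : ℕ) (ht : 1 ≤ t) (x : Fin (t - 1) → ℤ_[p])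
    (hx : AlgebraicIndependent ℚ fun i => ((x i : ℤ_[p]) : ℚ_[p])) :
    (∀ q' : ℕ, q'.Prime → q' ≠ p → q' ≠ q →
      Nat.card (↥(G1 p q t x) ⧸ smulRange q' ↥(G1 p q t x)) = q') ∧
    Nat.card (↥(G1 p q t x) ⧸ smulRange p ↥(G1 p q t x)) = p ^ t ∧
    Nat.card (↥(G1 p q t x) ⧸ smulRange q ↥(G1 p q t x)) = q ^ t := by
  have hp : p.Prime := Fact.out
  let e : G1 p q t x ≃+ ℤ × (Fin (t - 1) → ratPrimeTo p q hp hq) :=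
    ((G1 p q t x).equivMapOfInjective (PadicInt.Coe.ringHom (p := p)).toAddMonoidHom
      Subtype.coe_injective).trans
    ((AddEquiv.addSubgroupCongr (range_affineCombination hq x).symm).trans
      (AddMonoidHom.ofInjective (affineCombination_injective hq hx)).symm)
  have hcard (n : ℕ) [Fact n.Prime] (hn : n = p ∨ n = q) :
      Nat.card (↥(G1 p q t x) ⧸ smulRange n ↥(G1 p q t x)) = n ^ t := by
    let g := ratPrimeToReduce p q n hp hq hn
    let f : ℤ × (Fin (t - 1) → ratPrimeTo p q hp hq) →+ ZMod n × (Fin (t - 1) → ZMod n) :=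
      (Int.castAddHom (ZMod n)).prodMap (g.compLeft (Fin (t - 1)))
    rw [card_quotient_smulRange n e f]
    · rw [Nat.card_prod, Nat.card_fun, Nat.card_zmod, Nat.card_fin, ← pow_succ',
        Nat.sub_add_cancel ht]
    · exact Function.Surjective.prodMap ZMod.intCast_surjective
        (ratPrimeToReduce_surjective hn).comp_left
    · rintro ⟨m, r⟩
      have h1 : f (m, r) = 0 ↔ (m : ZMod n) = 0 ∧ ∀ i, g (r i) = 0 := by
        rw [Prod.ext_iff, funext_iff]
        rfl
      rw [h1, intCast_zmod_eq_zero_iff_exists_nsmul]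
      simp only [g, ratPrimeToReduce_eq_zero]
      constructor
      · rintro ⟨⟨l, hl⟩, h⟩
        choose s hs using h
        exact ⟨(l, s), Prod.ext hl (funext hs)⟩
      · rintro ⟨⟨l, s⟩, h⟩
        rw [Prod.ext_iff, funext_iff] at h
        exact ⟨⟨l, h.1⟩, fun i => ⟨s i, h.2 i⟩⟩
  refine ⟨fun n hn hnp hnq => ?_, hcard p (Or.inl rfl), ?_⟩
  · rw [card_quotient_smulRange n e ((Int.castAddHom (ZMod n)).comp (AddMonoidHom.fst _ _)),
      Nat.card_zmod]
    · exact ZMod.intCast_surjective.comp Prod.fst_surjective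
    · rintro ⟨m, r⟩
      refine (intCast_zmod_eq_zero_iff_exists_nsmul n m).trans ⟨?_, ?_⟩
      · rintro ⟨l, hl⟩
        choose s hs using fun i => ratPrimeTo_exists_nsmul_eq hn hnp hnq (r i)
        exact ⟨(l, s), Prod.ext hl (funext hs)⟩
      · rintro ⟨⟨l, s⟩, h⟩
        exact ⟨l, congrArg Prod.fst h⟩
  · have : Fact q.Prime := ⟨hq⟩
    exact hcard q (Or.inr rfl)
end

section
/- Let p be a prime. For every function t from the set of prime numbers to ℕ ∪ {∞} with t(p) ≠ 0, there exists an additive subgroup G of Zp such that for every prime q: if t(q) is finite then the quotient G/qG has exactly q^{t(q)} elements, and if t(q) = ∞ then G/qG is infinite. -/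
section QuotientCard

variable {A κ : Type*} [AddCommGroup A] {q : ℕ}

theorem mem_smulRange {n : ℕ} {x : A} : x ∈ smulRange n A ↔ ∃ y : A, n • y = x := Iff.rfl

theorem smulRange_eq_ker_pi (φ : κ → A →+ ZMod q)
    (hker : ∀ x, (∀ k, φ k x = 0) → ∃ y : A, q • y = x) :
    smulRange q A = (AddMonoidHom.pi φ).ker := by
  ext x
  rw [mem_smulRange, AddMonoidHom.mem_ker]
  constructor
  · rintro ⟨y, rfl⟩
    ext k
    simp
  · exact fun h => hker x fun k => congrFun h k

theorem card_quotient_smulRange_s7 [NeZero q] [Finite κ] (φ : κ → A →+ ZMod q)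
    (hker : ∀ x, (∀ k, φ k x = 0) → ∃ y : A, q • y = x)
    (hdual : ∀ k, ∃ x, φ k x = 1 ∧ ∀ j ≠ k, φ j x = 0) :
    Nat.card (A ⧸ smulRange q A) = q ^ Nat.card κ := by
  classical
  have := Fintype.ofFinite κ
  choose e he he' using hdual
  have hsurj : Function.Surjective (AddMonoidHom.pi φ) := by
    intro y
    refine ⟨∑ k, (y k).val • e k, ?_⟩
    ext j
    rw [AddMonoidHom.pi_apply, map_sum, Finset.sum_eq_single j]
    · simp [he]
    · intro k _ hk
      simp [he' k j hk.symm]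
    · simp
  rw [smulRange_eq_ker_pi φ hker,
    Nat.card_congr (QuotientAddGroup.quotientKerEquivOfSurjective _ hsurj).toEquiv]
  simp

theorem infinite_quotient_smulRange [Fact (1 < q)] [Infinite κ] (φ : κ → A →+ ZMod q)
    (hker : ∀ x, (∀ k, φ k x = 0) → ∃ y : A, q • y = x)
    (hdual : ∀ k, ∃ x, φ k x = 1 ∧ ∀ j ≠ k, φ j x = 0) :
    Infinite (A ⧸ smulRange q A) := by
  choose e he he' using hdual
  refine Infinite.of_injective (fun k => (e k : A ⧸ smulRange q A)) fun k j hkj => ?_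
  by_contra hne
  have hmem := QuotientAddGroup.eq.mp hkj
  rw [smulRange_eq_ker_pi φ hker, AddMonoidHom.mem_ker] at hmem
  have := congrFun hmem k
  simp [he, he' j k hne] at this

end QuotientCard

section Padic

theorem toZMod_eq_zero_iff {q : ℕ} [Fact q.Prime] (z : ℤ_[q]) :
    PadicInt.toZMod z = 0 ↔ ‖z‖ < 1 := by
  rw [← RingHom.mem_ker, PadicInt.ker_toZMod, PadicInt.maximalIdeal_eq_span_p,
    Ideal.mem_span_singleton, ← PadicInt.norm_lt_one_iff_dvd]

/-- The reduction modulo `q` of an additive map with values in the `q`-adic integers. -/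
noncomputable def padicReduction {A : Type*} [AddCommGroup A] {q : ℕ} [Fact q.Prime]
    (f : A →+ ℚ_[q]) (hf : ∀ x, ‖f x‖ ≤ 1) : A →+ ZMod q :=
  (PadicInt.toZMod (p := q)).toAddMonoidHom.comp
    (f.codRestrict (PadicInt.subring q).toAddSubgroup hf)

theorem padicReduction_apply {A : Type*} [AddCommGroup A] {q : ℕ} [Fact q.Prime]
    (f : A →+ ℚ_[q]) (hf : ∀ x, ‖f x‖ ≤ 1) (x : A) :
    padicReduction f hf x = PadicInt.toZMod (⟨f x, hf x⟩ : ℤ_[q]) := rfl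

theorem padicReduction_eq_zero_iff {A : Type*} [AddCommGroup A] {q : ℕ} [Fact q.Prime]
    (f : A →+ ℚ_[q]) (hf : ∀ x, ‖f x‖ ≤ 1) (x : A) :
    padicReduction f hf x = 0 ↔ ‖f x‖ < 1 :=
  toZMod_eq_zero_iff (⟨f x, hf x⟩ : ℤ_[q])

theorem padicReduction_eq_one {A : Type*} [AddCommGroup A] {q : ℕ} [Fact q.Prime]
    (f : A →+ ℚ_[q]) (hf : ∀ x, ‖f x‖ ≤ 1) {x : A} (hx : f x = 1) :
    padicReduction f hf x = 1 := by
  rw [padicReduction_apply, ← map_one (PadicInt.toZMod (p := q))]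
  congr 1
  exact Subtype.ext hx

theorem norm_inv_prime_mul_le_one {q r : ℕ} [hq : Fact q.Prime] [hr : Fact r.Prime] {y : ℚ_[r]}
    (hy : ‖y‖ ≤ 1) (hlt : q = r → ‖y‖ < 1) : ‖(q : ℚ_[r])⁻¹ * y‖ ≤ 1 := by
  by_cases h : q = r
  · subst h
    obtain ⟨z, hz⟩ := (PadicInt.norm_lt_one_iff_dvd (⟨y, hy⟩ : ℤ_[q])).mp (hlt rfl)
    have hyz : y = q * (z : ℚ_[q]) := by simpa using congrArg Subtype.val hz
    rw [hyz, inv_mul_cancel_left₀ (by exact_mod_cast hq.out.ne_zero)]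
    exact z.2
  · have : ‖(q : ℚ_[r])‖ = 1 := by
      rw [Padic.norm_natCast_eq_one_iff]
      exact (Nat.coprime_primes hr.out hq.out).mpr (Ne.symm h)
    simpa [this] using hy

variable (p : ℕ) [Fact p.Prime]

theorem infinite_of_basis_padic {ι : Type*} (b : Module.Basis ι ℚ ℚ_[p]) : Infinite ι := by
  by_contra h
  rw [not_infinite_iff_finite] at h
  have := Module.Finite.of_basis b
  have hc : Countable ℚ_[p] := Finsupp.Countable.of_moduleFinite (R := ℚ)
  exact absurd (continuum_le_cardinal_of_nontriviallyNormedField ℚ_[p])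
    (not_le.mpr ((Cardinal.mk_le_aleph0_iff.mpr hc).trans_lt Cardinal.aleph0_lt_continuum))

theorem exists_basis_padic_norm_eq_one :
    ∃ (ι : Type) (b : Module.Basis ι ℚ ℚ_[p]), ∀ i, ‖b i‖ = 1 := by
  let b := Module.Basis.ofVectorSpace ℚ ℚ_[p]
  have hp : (p : ℚ) ≠ 0 := by exact_mod_cast (Fact.out : p.Prime).ne_zero
  have hp' : (p : ℝ) ≠ 0 := by exact_mod_cast (Fact.out : p.Prime).ne_zero
  refine ⟨_, b.unitsSMul fun i => Units.mk0 ((p : ℚ) ^ (-(b i).valuation)) (zpow_ne_zero _ hp),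
    fun i => ?_⟩
  rw [Module.Basis.unitsSMul_apply, Units.smul_def, Units.val_mk0, Rat.smul_def, norm_mul,
    Padic.norm_eq_zpow_neg_valuation (b.ne_zero i)]
  push_cast
  rw [Padic.norm_p_zpow, ← zpow_add₀ hp']
  simp

variable {p} {ι : Type*} (b : Module.Basis ι ℚ ℚ_[p]) (S : ℕ → Set ι)

/-- The `q`-adic value of the `i`-th rational coordinate of a `p`-adic integer. -/
noncomputable def padicCoord (q : ℕ) [Fact q.Prime] (i : ι) : ℤ_[p] →+ ℚ_[q] :=
  ((algebraMap ℚ ℚ_[q]).toAddMonoidHom.comp (b.coord i).toAddMonoidHom).comp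
    (PadicInt.Coe.ringHom (p := p)).toAddMonoidHom

theorem padicCoord_apply (q : ℕ) [Fact q.Prime] (i : ι) (x : ℤ_[p]) :
    padicCoord b q i x = ((b.repr (x : ℚ_[p]) i : ℚ) : ℚ_[q]) := rfl

/-- The `p`-adic integers whose coordinates indexed by `S q` are `q`-integral, for all primes
`q`. -/
def integralCoordSubgroup : AddSubgroup ℤ_[p] where
  carrier := {x | ∀ (q : ℕ) [Fact q.Prime], ∀ i ∈ S q, ‖padicCoord b q i x‖ ≤ 1}
  zero_mem' q _ i _ := by simp
  add_mem' {x y} hx hy q _ i hi := by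
    rw [map_add]
    exact (Padic.nonarchimedean _ _).trans (max_le (hx q i hi) (hy q i hi))
  neg_mem' {x} hx q _ i hi := by
    rw [map_neg, norm_neg]
    exact hx q i hi

variable {b S}

theorem exists_prime_nsmul_eq {q : ℕ} [hq : Fact q.Prime] (x : integralCoordSubgroup b S)
    (hcoord : ∀ i ∈ S q, ‖padicCoord b q i x‖ < 1) (hp : q = p → ‖(x : ℤ_[p])‖ < 1) :
    ∃ y : integralCoordSubgroup b S, q • y = x := by
  have hq0 : (q : ℚ_[p]) ≠ 0 := by exact_mod_cast hq.out.ne_zero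
  obtain ⟨y, hyx⟩ : ∃ y : ℤ_[p], (y : ℚ_[p]) = (q : ℚ_[p])⁻¹ * (x : ℤ_[p]) :=
    ⟨⟨_, norm_inv_prime_mul_le_one (x : ℤ_[p]).2 hp⟩, rfl⟩
  refine ⟨⟨y, fun r _ i hi => ?_⟩, ?_⟩
  · have hy : (y : ℚ_[p]) = (q : ℚ)⁻¹ • ((x : ℤ_[p]) : ℚ_[p]) := by
      rw [Rat.smul_def, hyx]
      push_cast
      rfl
    have : padicCoord b r i y = (q : ℚ_[r])⁻¹ * padicCoord b r i x := by
      simp [padicCoord_apply, hy]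
    rw [this]
    refine norm_inv_prime_mul_le_one (x.2 r i hi) ?_
    rintro rfl
    exact hcoord i hi
  · refine Subtype.ext (Subtype.ext ?_)
    simp [hyx, hq0]

theorem padicCoord_basis {q : ℕ} [Fact q.Prime] {i : ι} {x : ℤ_[p]} (hx : (x : ℚ_[p]) = b i)
    (j : ι) [Decidable (i = j)] : padicCoord b q j x = if i = j then 1 else 0 := by
  classical
  rw [padicCoord_apply, hx, b.repr_self, Finsupp.single_apply]
  split_ifs <;> simp

theorem exists_mem_integralCoordSubgroup_eq_basis (hb : ∀ i, ‖b i‖ = 1) (i : ι) :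
    ∃ x : integralCoordSubgroup b S, ((x : ℤ_[p]) : ℚ_[p]) = b i := by
  classical
  obtain ⟨x, hx⟩ : ∃ x : ℤ_[p], (x : ℚ_[p]) = b i := ⟨⟨b i, (hb i).le⟩, rfl⟩
  refine ⟨⟨x, fun q _ j _ => ?_⟩, hx⟩
  rw [padicCoord_basis hx]
  split_ifs <;> simp

variable (b S) in
/-- The reduction modulo `q` of a coordinate indexed by `S q`. -/
noncomputable def coordReduction (q : ℕ) [Fact q.Prime] (i : S q) :
    integralCoordSubgroup b S →+ ZMod q :=
  padicReduction ((padicCoord b q i).comp (integralCoordSubgroup b S).subtype)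
    fun x => x.2 q i i.2

theorem coordReduction_eq_zero_iff {q : ℕ} [Fact q.Prime] (i : S q)
    (x : integralCoordSubgroup b S) :
    coordReduction b S q i x = 0 ↔ ‖padicCoord b q i x‖ < 1 :=
  padicReduction_eq_zero_iff _ _ x

theorem coordReduction_basis {q : ℕ} [Fact q.Prime] {i : ι} {x : integralCoordSubgroup b S}
    (hx : ((x : ℤ_[p]) : ℚ_[p]) = b i) (j : S q) [Decidable (i = j)] :
    coordReduction b S q j x = if i = j then 1 else 0 := by
  split_ifs with h
  · exact padicReduction_eq_one _ _ (by simp [padicCoord_basis hx, h])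
  · rw [coordReduction_eq_zero_iff, padicCoord_basis hx, if_neg h]
    simp

/-- Every `q ≠ p` admits a family of functionals indexed by `S q` as in
`card_quotient_smulRange`. -/
theorem exists_reductions_of_ne (hb : ∀ i, ‖b i‖ = 1) {q : ℕ} [Fact q.Prime] (hqp : q ≠ p) :
    ∃ φ : S q → integralCoordSubgroup b S →+ ZMod q,
      (∀ x, (∀ k, φ k x = 0) → ∃ y : integralCoordSubgroup b S, q • y = x) ∧
      ∀ k, ∃ x, φ k x = 1 ∧ ∀ j ≠ k, φ j x = 0 := by
  classical
  refine ⟨coordReduction b S q, fun x hx => exists_prime_nsmul_eq x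
    (fun i hi => (coordReduction_eq_zero_iff ⟨i, hi⟩ x).mp (hx ⟨i, hi⟩)) (absurd · hqp),
    fun k => ?_⟩
  obtain ⟨x, hx⟩ := exists_mem_integralCoordSubgroup_eq_basis (S := S) hb k
  refine ⟨x, by simp [coordReduction_basis hx], fun j hj => ?_⟩
  rw [coordReduction_basis hx, if_neg fun h => hj (Subtype.ext h.symm)]

/-- At `p`, the reduction modulo `p` of the `p`-adic integer itself is one more functional. -/
theorem exists_reductions_self (hb : ∀ i, ‖b i‖ = 1) {i₀ : ι} (hi₀ : i₀ ∉ S p) :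
    ∃ φ : Option (S p) → integralCoordSubgroup b S →+ ZMod p,
      (∀ x, (∀ k, φ k x = 0) → ∃ y : integralCoordSubgroup b S, p • y = x) ∧
      ∀ k, ∃ x, φ k x = 1 ∧ ∀ j ≠ k, φ j x = 0 := by
  classical
  let ψ : integralCoordSubgroup b S →+ ZMod p :=
    (PadicInt.toZMod (p := p)).toAddMonoidHom.comp (integralCoordSubgroup b S).subtype
  have hψ (x) : ψ x = 0 ↔ ‖(x : ℤ_[p])‖ < 1 := toZMod_eq_zero_iff (x : ℤ_[p])
  obtain ⟨u, hu⟩ := exists_mem_integralCoordSubgroup_eq_basis (S := S) hb i₀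
  have hu0 : ψ u ≠ 0 := by
    rw [Ne, hψ, PadicInt.norm_def, hu, hb]
    exact lt_irrefl 1
  have hcoord_u (j : S p) : coordReduction b S p j u = 0 := by
    rw [coordReduction_basis hu, if_neg]
    rintro rfl
    exact hi₀ j.2
  have hadjust (a : ZMod p) : ((a / ψ u).val : ZMod p) * ψ u = a := by
    rw [ZMod.natCast_zmod_val, div_mul_cancel₀ _ hu0]
  refine ⟨fun k => k.elim ψ (coordReduction b S p), fun x hx => exists_prime_nsmul_eq x
    (fun i hi => (coordReduction_eq_zero_iff ⟨i, hi⟩ x).mp (hx (some ⟨i, hi⟩)))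
    (fun _ => (hψ x).mp (hx none)), ?_⟩
  rintro (_ | k)
  · refine ⟨(1 / ψ u).val • u, ?_, ?_⟩
    · simpa only [Option.elim, map_nsmul, nsmul_eq_mul] using hadjust 1
    · rintro (_ | j) hj
      · exact absurd rfl hj
      · simp [hcoord_u]
  · obtain ⟨x, hx⟩ := exists_mem_integralCoordSubgroup_eq_basis (S := S) hb k
    refine ⟨x - (ψ x / ψ u).val • u, ?_, ?_⟩
    · simp [hcoord_u, coordReduction_basis hx]
    · rintro (_ | j) hj
      · simp only [Option.elim, map_sub, map_nsmul, nsmul_eq_mul, hadjust, sub_self]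
      · have : (k : ι) ≠ j := fun h => hj (congrArg some (Subtype.ext h.symm))
        simp [hcoord_u, coordReduction_basis hx, this]

end Padic

theorem card_quotient_smulRange_of_enatCard {A κ : Type*} [AddCommGroup A] {q : ℕ}
    [hq : Fact q.Prime] {n : ℕ∞} (hn : ENat.card κ = n)
    (h : ∃ φ : κ → A →+ ZMod q, (∀ x, (∀ k, φ k x = 0) → ∃ y : A, q • y = x) ∧
      ∀ k, ∃ x, φ k x = 1 ∧ ∀ j ≠ k, φ j x = 0) :
    (∀ k : ℕ, n = (k : ℕ∞) → Nat.card (A ⧸ smulRange q A) = q ^ k) ∧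
      (n = ⊤ → Infinite (A ⧸ smulRange q A)) := by
  obtain ⟨φ, hker, hdual⟩ := h
  refine ⟨fun k hk => ?_, fun htop => ?_⟩
  · rw [hk] at hn
    have : Finite κ := ENat.card_lt_top.mp (hn ▸ ENat.natCast_lt_top k)
    rw [ENat.card_eq_coe_natCard, Nat.cast_inj] at hn
    rw [card_quotient_smulRange_s7 φ hker hdual, hn]
  · have : Infinite κ := ENat.card_eq_top.mp (hn.trans htop)
    have : Fact (1 < q) := ⟨hq.out.one_lt⟩
    exact infinite_quotient_smulRange φ hker hdual

/-- for every assignment `t` of an element of `ℕ ∪ {∞}` to each prime, with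
`t p ≠ 0`, there is an additive subgroup `G` of `ℤ_p` such that for every prime `q`, the
quotient `G/qG` has exactly `q ^ t q` elements when `t q` is finite, and is infinite when
`t q = ∞`. -/
theorem stmt_7 (p : ℕ) [Fact p.Prime] (t : ℕ → ℕ∞) (htp : t p ≠ 0) :
    ∃ G : AddSubgroup ℤ_[p], ∀ q : ℕ, q.Prime →
      (∀ k : ℕ, t q = (k : ℕ∞) → Nat.card (↥G ⧸ smulRange q ↥G) = q ^ k) ∧
      (t q = ⊤ → Infinite (↥G ⧸ smulRange q ↥G)) := by
  obtain ⟨ι, b, hb⟩ := exists_basis_padic_norm_eq_one p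
  have : Infinite ι := infinite_of_basis_padic p b
  obtain ⟨i₀⟩ : Nonempty ι := inferInstance
  have hset (n : ℕ∞) : ∃ s ⊆ ({i₀}ᶜ : Set ι), s.encard = n :=
    Set.exists_subset_encard_eq <| by
      rw [(Set.finite_singleton i₀).infinite_compl.encard_eq]
      exact le_top
  choose s hs hcard using hset
  let S (q : ℕ) : Set ι := s (if q = p then t p - 1 else t q)
  refine ⟨integralCoordSubgroup b S, fun q hq => ?_⟩
  have : Fact q.Prime := ⟨hq⟩
  by_cases hqp : q = p
  · subst hqp
    refine card_quotient_smulRange_of_enatCard (κ := Option (S q)) ?_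
      (exists_reductions_self hb (i₀ := i₀) fun h => hs _ h rfl)
    have hS : ENat.card (S q) = t q - 1 := by simp [S, hcard]
    cases finite_or_infinite (S q) with
    | inl h =>
      rw [ENat.card_eq_coe_natCard, Finite.card_option, Nat.cast_add, ← ENat.card_eq_coe_natCard,
        hS, Nat.cast_one, tsub_add_cancel_of_le (Order.one_le_iff_ne_zero.mpr htp)]
    | inr h =>
      rw [ENat.card_eq_top_of_infinite] at hS ⊢
      exact (top_le_iff.mp (hS.le.trans tsub_le_self)).symm
  · refine card_quotient_smulRange_of_enatCard (κ := S q) ?_ (exists_reductions_of_ne hb hqp)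
    simp [S, hcard, hqp]
end

section
/- Let p be an odd prime, s a divisor of p−1, n ≥ 1, and D a subgroup of Zp^× such that D^s := {d^s : d ∈ D} is dense in 1 + p^n·Zp. For ξ a unit of ℤ/pℤ, let D(ξ) := {x^s : x ∈ D, x ≡ ξ (mod p)}. If D(ξ) is nonempty, then D(ξ) is dense in 1 + p^n·Zp. -/
open Filter Topology in
/-- If `w` is congruent to `1` modulo `p`, then `w ^ p ^ k` tends to `1` in `ℤ_[p]`. -/
theorem PadicInt.tendsto_pow_prime_pow_one {p : ℕ} [Fact p.Prime] {w : ℤ_[p]}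
    (hw : ‖w - 1‖ < 1) : Tendsto (fun k : ℕ => w ^ p ^ k) atTop (𝓝 1) := by
  rw [tendsto_iff_norm_sub_tendsto_zero]
  have hp : ‖(p : ℤ_[p])‖ < 1 := (PadicInt.norm_lt_one_iff_dvd _).2 dvd_rfl
  have hlim := (tendsto_pow_atTop_nhds_zero_of_lt_one (norm_nonneg (p : ℤ_[p])) hp).comp
    (tendsto_add_atTop_nat 1)
  refine squeeze_zero (fun k => norm_nonneg _) (fun k => ?_) hlim
  have hdvd := dvd_sub_pow_of_dvd_sub ((PadicInt.norm_lt_one_iff_dvd _).1 hw) k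
  rw [one_pow] at hdvd
  obtain ⟨c, hc⟩ := hdvd
  rw [hc, norm_mul, norm_pow]
  exact mul_le_of_le_one_right (by positivity) (PadicInt.norm_le_one c)

/-- A closed ball around `1` in `ℤ_[p]` is closed under multiplication. -/
theorem PadicInt.norm_mul_sub_one_le {p : ℕ} [Fact p.Prime] {r : ℝ} {a b : ℤ_[p]}
    (ha : ‖a - 1‖ ≤ r) (hb : ‖b - 1‖ ≤ r) : ‖a * b - 1‖ ≤ r := by
  have h : a * b - 1 = a * (b - 1) + (a - 1) := by ring
  rw [h]
  refine (PadicInt.nonarchimedean _ _).trans (max_le ?_ ha)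
  rw [norm_mul]
  exact (mul_le_of_le_one_left (norm_nonneg _) (PadicInt.norm_le_one a)).trans hb

/-- if `D ≤ ℤ_pˣ` is such that `D ^ s` is dense in `1 + p ^ n ℤ_p`, and
`D(ξ) = {x ^ s : x ∈ D, x ≡ ξ (mod p)}` is nonempty, then `D(ξ)` is dense in
`1 + p ^ n ℤ_p`. -/
theorem stmt_8 (p : ℕ) [Fact p.Prime] (hp : p ≠ 2) (s : ℕ) (hs : s ∣ p - 1)
    (n : ℕ) (hn : 1 ≤ n) (D : Subgroup ℤ_[p]ˣ)
    (hdense : closure {z : ℤ_[p] | ∃ d ∈ D, z = (d : ℤ_[p]) ^ s}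
      = {x : ℤ_[p] | ‖x - 1‖ ≤ (p : ℝ) ^ (-(n : ℤ))})
    (ξ : (ZMod p)ˣ)
    (hne : {z : ℤ_[p] | ∃ d ∈ D,
      PadicInt.toZMod (d : ℤ_[p]) = (ξ : ZMod p) ∧ z = (d : ℤ_[p]) ^ s}.Nonempty) :
    closure {z : ℤ_[p] | ∃ d ∈ D,
        PadicInt.toZMod (d : ℤ_[p]) = (ξ : ZMod p) ∧ z = (d : ℤ_[p]) ^ s}
      = {x : ℤ_[p] | ‖x - 1‖ ≤ (p : ℝ) ^ (-(n : ℤ))} := by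
  have hmem : ∀ d ∈ D, ‖(d : ℤ_[p]) ^ s - 1‖ ≤ (p : ℝ) ^ (-(n : ℤ)) := fun d hd => by
    have : (d : ℤ_[p]) ^ s ∈ closure {z : ℤ_[p] | ∃ d ∈ D, z = (d : ℤ_[p]) ^ s} :=
      subset_closure ⟨d, hd, rfl⟩
    rwa [hdense] at this
  have hlt : (p : ℝ) ^ (-(n : ℤ)) < 1 :=
    zpow_lt_one_of_neg₀ (by exact_mod_cast (Fact.out : p.Prime).one_lt) (by omega)
  obtain ⟨-, e, he, heξ, -⟩ := hne
  apply Set.Subset.antisymm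
  · rw [← hdense]
    exact closure_mono fun z ⟨d, hd, _, hz⟩ => ⟨d, hd, hz⟩
  · intro x hx
    have hinv : (e : ℤ_[p]) ^ s * ((e⁻¹ : ℤ_[p]ˣ) : ℤ_[p]) ^ s = 1 := by
      rw [← mul_pow, Units.mul_inv, one_pow]
    have hy : ((e⁻¹ : ℤ_[p]ˣ) : ℤ_[p]) ^ s * x ∈
        closure {z : ℤ_[p] | ∃ d ∈ D, z = (d : ℤ_[p]) ^ s} := by
      rw [hdense]
      exact PadicInt.norm_mul_sub_one_le (hmem _ (D.inv_mem he)) hx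
    have hcont : Continuous fun y : ℤ_[p] => (e : ℤ_[p]) ^ s * y := by fun_prop
    have key := map_mem_closure (t := closure {z : ℤ_[p] | ∃ d ∈ D,
      PadicInt.toZMod (d : ℤ_[p]) = (ξ : ZMod p) ∧ z = (d : ℤ_[p]) ^ s}) hcont hy ?_
    · rwa [closure_closure, ← mul_assoc, hinv, one_mul] at key
    rintro _ ⟨d, hd, rfl⟩
    have hlim := (PadicInt.tendsto_pow_prime_pow_one
      ((hmem _ (D.inv_mem hd)).trans_lt hlt)).const_mul ((e : ℤ_[p]) ^ s * (d : ℤ_[p]) ^ s)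
    rw [mul_one] at hlim
    refine mem_closure_of_tendsto hlim (Filter.Eventually.of_forall fun k =>
      ⟨e * d * d⁻¹ ^ p ^ k, D.mul_mem (D.mul_mem he hd) (D.pow_mem (D.inv_mem hd) _), ?_, ?_⟩)
    · rw [Units.val_mul, Units.val_mul, Units.val_pow_eq_pow_val, map_mul, map_mul, map_pow,
        ZMod.pow_card_pow, mul_assoc, ← map_mul, Units.mul_inv, map_one, mul_one, heξ]
    · push_cast
      ring
end

section
/- Let p be a prime, let G be an additive subgroup of Zp, and let n ≥ 1 be an integer such that the quotient G/nG is infinite. Then for every c ∈ G and every γ ∈ ℕ, the image of the set {x ∈ G : v_p(x − c) ≥ γ} under the quotient map G → G/nG is infinite; that is, every valuation ball in G around a point of G contains representatives of infinitely many cosets of nG. -/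
/-- if `G ≤ ℤ_p` is an additive subgroup with `G/nG` infinite, then every
valuation ball `{x ∈ G : v_p (x - c) ≥ γ}` around a point `c ∈ G` meets infinitely many
cosets of `nG`. -/
theorem stmt_11 (p : ℕ) [Fact p.Prime] (G : AddSubgroup ℤ_[p]) (n : ℕ) (hn : 1 ≤ n)
    (hinf : Infinite (↥G ⧸ smulRange n ↥G)) :
    ∀ (c : ↥G) (γ : ℕ),
      Set.Infinite ((QuotientAddGroup.mk : ↥G → ↥G ⧸ smulRange n ↥G) ''
        {x : ↥G | ‖(x : ℤ_[p]) - (c : ℤ_[p])‖ ≤ (p : ℝ) ^ (-(γ : ℤ))}) := by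
  intro c γ hfin
  have : NeZero (p ^ γ) := ⟨pow_ne_zero _ (Fact.out : p.Prime).ne_zero⟩
  let π : ↥G → ↥G ⧸ smulRange n ↥G := QuotientAddGroup.mk
  let r : ↥G → ZMod (p ^ γ) := fun x => PadicInt.toZModPow γ (x : ℤ_[p])
  have hfiber : ∀ a : ZMod (p ^ γ), (π '' {x | r x = a}).Finite := by
    intro a
    rcases Set.eq_empty_or_nonempty {x | r x = a} with h | ⟨y, hy⟩
    · simp [h]
    · refine (hfin.image (fun q => q + π (y - c))).subset ?_
      rintro _ ⟨x, hx, rfl⟩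
      refine ⟨π (x - (y - c)), ⟨x - (y - c), ?_, rfl⟩, ?_⟩
      · have hxy : (x : ℤ_[p]) - y ∈ RingHom.ker (PadicInt.toZModPow (p := p) γ) := by
          rw [RingHom.mem_ker, map_sub, sub_eq_zero]
          exact Eq.trans hx (Eq.symm hy)
        rw [PadicInt.ker_toZModPow, ← PadicInt.norm_le_pow_iff_mem_span_pow] at hxy
        have hsub : ((x - (y - c) : ↥G) : ℤ_[p]) - c = x - y := by
          push_cast
          ring
        rw [Set.mem_ofPred_eq, hsub]
        exact hxy
      · exact congrArg π (sub_add_cancel x (y - c))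
  have huniv : (Set.univ : Set (↥G ⧸ smulRange n ↥G)).Finite := by
    refine (Set.finite_iUnion hfiber).subset fun q _ => ?_
    obtain ⟨x, rfl⟩ := QuotientAddGroup.mk_surjective q
    exact Set.mem_iUnion.2 ⟨r x, x, rfl, rfl⟩
  exact Set.infinite_univ huniv
end

section
/- Let p be an odd prime, s a divisor of p−1, n ≥ 1, and D a subgroup of Zp^× such that D^s := {d^s : d ∈ D} is dense in 1 + p^n·Zp. Let k_1, …, k_m ∈ ℕ, n_1, …, n_m ≥ 1 be integers, let ξ_1, …, ξ_m be units of ℤ/pℤ, and let x_1, …, x_m ∈ 1 + p^n·Zp. For n' ≥ 1 and a unit ξ of ℤ/pℤ set D_{n'}(ξ) := {(t^s)^{n'} : t ∈ D, t ≡ ξ (mod p)}, and let X := {z ∈ D^s : for every i, x_i · z^{k_i} ∈ D_{n_i}(ξ_i)}. If X is nonempty, then the closure of X in Zp is a finite union of cosets c·(1 + p^r·Zp) with c ∈ 1 + p^n·Zp, where r := n + v_p(n_1·n_2·⋯·n_m); in particular X is dense in a finite union of multiplicative cosets of 1 + p^r·Zp inside 1 + p^n·Zp. -/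
/-- An isometry from a compact metric space to itself is surjective. -/
theorem Isometry.surjective_of_compactSpace {α : Type*} [MetricSpace α] [CompactSpace α]
    {f : α → α} (hf : Isometry f) : Function.Surjective f := by
  intro y
  by_contra hy
  have hclosed : IsClosed (Set.range f) := (isCompact_range hf.continuous).isClosed
  obtain ⟨ε, hε, hball⟩ := Metric.isOpen_iff.mp hclosed.isOpen_compl y hy
  have hfar : ∀ a, ε ≤ dist (f a) y := fun a => by
    by_contra! h
    exact hball (Metric.mem_ball.mpr h) ⟨a, rfl⟩
  have hsep : ∀ i j, ε ≤ dist (f^[i + (j + 1)] y) (f^[i] y) := fun i j => by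
    induction i with
    | zero =>
      rw [zero_add, Function.iterate_succ_apply']
      exact hfar _
    | succ i ih =>
      rwa [Nat.add_right_comm, Function.iterate_succ_apply', Function.iterate_succ_apply',
        hf.dist_eq]
  obtain ⟨a, φ, hφ, hlim⟩ := CompactSpace.tendsto_subseq (fun i => f^[i] y)
  obtain ⟨N, hN⟩ := Metric.cauchySeq_iff.mp hlim.cauchySeq ε hε
  have hclose := hN (N + 1) (Nat.le_succ N) N le_rfl
  obtain ⟨j, hj⟩ := Nat.exists_eq_add_of_lt (hφ (Nat.lt_succ_self N))
  simp only [Function.comp_apply, Nat.succ_eq_add_one] at hclose hj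
  rw [hj, add_assoc] at hclose
  exact (hsep _ _).not_gt hclose

namespace PadicInt

variable {p : ℕ} [Fact p.Prime]

theorem norm_le_pow_iff_pow_dvd (x : ℤ_[p]) (n : ℕ) :
    ‖x‖ ≤ (p : ℝ) ^ (-(n : ℤ)) ↔ (p : ℤ_[p]) ^ n ∣ x := by
  rw [norm_le_pow_iff_mem_span_pow, Ideal.mem_span_singleton]

theorem norm_eq_one_iff_not_dvd (x : ℤ_[p]) : ‖x‖ = 1 ↔ ¬(p : ℤ_[p]) ∣ x := by
  rw [← norm_lt_one_iff_dvd, not_lt]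
  exact ⟨fun h => h.ge, fun h => le_antisymm (norm_le_one x) h⟩

theorem norm_geom_sum₂_of_prime (hp : p ≠ 2) {x y : ℤ_[p]} (hxy : (p : ℤ_[p]) ∣ x - y)
    (hx : ¬(p : ℤ_[p]) ∣ x) {q : ℕ} (hq : q.Prime) :
    ‖∑ i ∈ Finset.range q, x ^ i * y ^ (q - 1 - i)‖ = ‖(q : ℤ_[p])‖ := by
  have hpp : p.Prime := Fact.out
  by_cases hqp : q = p
  · subst hqp
    have h := emultiplicity_geom_sum₂_eq_one prime_p (hpp.odd_of_ne_two hp) hxy hx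
    obtain ⟨h1, h2⟩ := emultiplicity_eq_coe.mp (h.trans Nat.cast_one.symm)
    rw [pow_one] at h1
    obtain ⟨u, hu⟩ := h1
    have hu1 : ‖u‖ = 1 := by
      rw [norm_eq_one_iff_not_dvd]
      rintro ⟨v, rfl⟩
      exact h2 ⟨v, by rw [hu]; ring⟩
    rw [hu, norm_mul, hu1, mul_one]
  · have hq' : ¬(p : ℤ_[p]) ∣ (q : ℤ_[p]) := by
      rw [← norm_lt_one_iff_dvd, norm_natCast_lt_one_iff, Nat.prime_dvd_prime_iff_eq hpp hq]
      exact fun h => hqp h.symm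
    rw [(norm_eq_one_iff_not_dvd _).mpr hq', norm_eq_one_iff_not_dvd]
    exact not_dvd_geom_sum₂ prime_p hxy hx hq'

/-- Lifting the exponent for `ℤ_[p]` with `p` odd, in terms of norms. -/
theorem norm_pow_sub_pow (hp : p ≠ 2) {x y : ℤ_[p]} (hxy : (p : ℤ_[p]) ∣ x - y)
    (hx : ¬(p : ℤ_[p]) ∣ x) (M : ℕ) : ‖x ^ M - y ^ M‖ = ‖(M : ℤ_[p])‖ * ‖x - y‖ := by
  induction M using induction_on_primes with
  | zero => simp
  | one => simp
  | prime_mul q a hq ih =>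
    rw [mul_comm q a, pow_mul, pow_mul, ← geom_sum₂_mul, norm_mul,
      norm_geom_sum₂_of_prime hp (hxy.trans (sub_dvd_pow_sub_pow x y a))
        (fun h => hx (prime_p.dvd_of_dvd_pow h)) hq, ih, Nat.cast_mul, norm_mul]
    ring

theorem norm_natCast_eq_zpow_neg_padicValNat {M : ℕ} (hM : M ≠ 0) :
    ‖(M : ℤ_[p])‖ = (p : ℝ) ^ (-(padicValNat p M : ℤ)) := by
  rw [norm_def, coe_natCast, Padic.norm_eq_zpow_neg_valuation (by exact_mod_cast hM),
    Padic.valuation_natCast]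

/-- For `p` odd, the `M`-th power map sends `1 + p ^ n ℤ_p` onto `1 + p ^ (n + v_p M) ℤ_p`. -/
theorem exists_pow_eq_of_pow_dvd_sub_one (hp : p ≠ 2) {n M : ℕ} (hn : 1 ≤ n) (hM : M ≠ 0)
    {y : ℤ_[p]} (hy : (p : ℤ_[p]) ^ (n + padicValNat p M) ∣ y - 1) :
    ∃ u : ℤ_[p], (p : ℤ_[p]) ^ n ∣ u - 1 ∧ u ^ M = y := by
  set v := padicValNat p M
  have hpn : (p : ℤ_[p]) ∣ (p : ℤ_[p]) ^ n := dvd_pow_self _ (by omega)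
  have hunit : ∀ t : ℤ_[p], ¬(p : ℤ_[p]) ∣ 1 + p ^ n * t := fun t h =>
    prime_p.not_dvd_one ((dvd_add_left (hpn.mul_right t)).mp h)
  have hdist : ∀ a b : ℤ_[p], ‖(1 + p ^ n * a) ^ M - (1 + p ^ n * b) ^ M‖
      = ‖(p : ℤ_[p]) ^ (n + v)‖ * ‖a - b‖ := fun a b => by
    have hab : (1 + (p : ℤ_[p]) ^ n * a) - (1 + p ^ n * b) = p ^ n * (a - b) := by ring
    rw [norm_pow_sub_pow hp (hab ▸ hpn.mul_right _) (hunit a), hab, norm_mul, pow_add, norm_mul,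
      norm_natCast_eq_zpow_neg_padicValNat hM, norm_p_pow v]
    ring
  have hdvd : ∀ t : ℤ_[p], ∃ c, (1 + (p : ℤ_[p]) ^ n * t) ^ M - 1 = p ^ (n + v) * c := fun t => by
    have h := hdist t 0
    rw [mul_zero, add_zero, one_pow] at h
    refine (norm_le_pow_iff_pow_dvd _ _).mp ?_
    rw [h, norm_p_pow]
    exact mul_le_of_le_one_right (by positivity) (norm_le_one _)
  choose f hf using hdvd
  have hiso : Isometry f := Isometry.of_dist_eq fun a b => by
    have hne : ‖(p : ℤ_[p]) ^ (n + v)‖ ≠ 0 :=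
      norm_ne_zero_iff.mpr (pow_ne_zero _ prime_p.ne_zero)
    refine mul_left_cancel₀ hne ?_
    rw [dist_eq_norm, dist_eq_norm, ← hdist a b, ← norm_mul, mul_sub, ← hf, ← hf,
      sub_sub_sub_cancel_right]
  obtain ⟨c, hc⟩ := hy
  obtain ⟨t, rfl⟩ := hiso.surjective_of_compactSpace c
  refine ⟨1 + p ^ n * t, ⟨t, by ring⟩, ?_⟩
  rw [← hf t] at hc
  exact (sub_left_injective hc).symm

/-- A closed set of units stable under `1 + p ^ r ℤ_p` is a finite union of cosets. -/
theorem exists_finset_eq_biUnion_cosets {C : Set ℤ_[p]} (hC : IsClosed C) {r : ℕ}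
    (hunit : ∀ c ∈ C, IsUnit c)
    (hstable : ∀ c ∈ C, ∀ w : ℤ_[p], ‖w - 1‖ ≤ (p : ℝ) ^ (-(r : ℤ)) → c * w ∈ C) :
    ∃ F : Finset ℤ_[p], (∀ c ∈ F, c ∈ C) ∧
      C = ⋃ c ∈ F, {y : ℤ_[p] | ∃ w : ℤ_[p], ‖w - 1‖ ≤ (p : ℝ) ^ (-(r : ℤ)) ∧ y = c * w} := by
  have hp0 : (0 : ℝ) < p := by exact_mod_cast (Fact.out : p.Prime).pos
  obtain ⟨F, hF, hcover⟩ := hC.isCompact.elim_nhds_subcover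
    (fun c => {y : ℤ_[p] | ∃ w : ℤ_[p], ‖w - 1‖ ≤ (p : ℝ) ^ (-(r : ℤ)) ∧ y = c * w})
    (fun c hc => by
      refine Filter.mem_of_superset (Metric.closedBall_mem_nhds c (zpow_pos hp0 (-(r : ℤ)))) ?_
      intro y hy
      obtain ⟨u, rfl⟩ := hunit c hc
      refine ⟨↑u⁻¹ * y, ?_, (u.mul_inv_cancel_left y).symm⟩
      rw [Metric.mem_closedBall, dist_eq_norm] at hy
      have h : (↑u⁻¹ : ℤ_[p]) * y - 1 = ↑u⁻¹ * (y - u) := by rw [mul_sub, Units.inv_mul]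
      rwa [h, norm_mul, norm_units, one_mul])
  refine ⟨F, hF, hcover.antisymm ?_⟩
  intro y hy
  simp only [Set.mem_iUnion] at hy
  obtain ⟨c, hcF, w, hw, rfl⟩ := hy
  exact hstable c (hF c hcF) w hw

end PadicInt


/-- with `D ≤ ℤ_pˣ` such that `D ^ s` is dense in `1 + p ^ n ℤ_p`, and
`D_{n'}(ξ) = {(t ^ s) ^ n' : t ∈ D, t ≡ ξ (mod p)}`, the set
`X = {z ∈ D ^ s : ∀ i, xᵢ z ^ kᵢ ∈ D_{nᵢ}(ξᵢ)}`, if nonempty, has closure a finite union of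
cosets `c (1 + p ^ r ℤ_p)` with `c ∈ 1 + p ^ n ℤ_p`, where `r = n + v_p (n₁ ⋯ n_m)`. -/
theorem stmt_16 (p : ℕ) [Fact p.Prime] (hp : p ≠ 2) (s : ℕ) (hs : s ∣ p - 1)
    (n : ℕ) (hn : 1 ≤ n) (D : Subgroup ℤ_[p]ˣ)
    (hdense : closure {z : ℤ_[p] | ∃ d ∈ D, z = (d : ℤ_[p]) ^ s}
      = {x : ℤ_[p] | ‖x - 1‖ ≤ (p : ℝ) ^ (-(n : ℤ))})
    (m : ℕ) (k : Fin m → ℕ) (nn : Fin m → ℕ) (hnn : ∀ i, 1 ≤ nn i)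
    (ξ : Fin m → (ZMod p)ˣ) (x : Fin m → ℤ_[p])
    (hx : ∀ i, ‖x i - 1‖ ≤ (p : ℝ) ^ (-(n : ℤ)))
    (hX : {z : ℤ_[p] | (∃ d ∈ D, z = (d : ℤ_[p]) ^ s) ∧
      ∀ i, ∃ t ∈ D, PadicInt.toZMod (t : ℤ_[p]) = (ξ i : ZMod p) ∧
        x i * z ^ (k i) = ((t : ℤ_[p]) ^ s) ^ (nn i)}.Nonempty) :
    ∃ F : Finset ℤ_[p], (∀ c ∈ F, ‖c - 1‖ ≤ (p : ℝ) ^ (-(n : ℤ))) ∧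
      closure {z : ℤ_[p] | (∃ d ∈ D, z = (d : ℤ_[p]) ^ s) ∧
          ∀ i, ∃ t ∈ D, PadicInt.toZMod (t : ℤ_[p]) = (ξ i : ZMod p) ∧
            x i * z ^ (k i) = ((t : ℤ_[p]) ^ s) ^ (nn i)} =
        ⋃ c ∈ F, {y : ℤ_[p] | ∃ w : ℤ_[p],
          ‖w - 1‖ ≤ (p : ℝ) ^ (-((n + padicValNat p (∏ i, nn i) : ℕ) : ℤ)) ∧ y = c * w} := by
  have hpp : p.Prime := Fact.out
  set E : Set ℤ_[p] := {z : ℤ_[p] | ∃ d ∈ D, z = (d : ℤ_[p]) ^ s}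
  set X : Set ℤ_[p] := {z : ℤ_[p] | (∃ d ∈ D, z = (d : ℤ_[p]) ^ s) ∧
      ∀ i, ∃ t ∈ D, PadicInt.toZMod (t : ℤ_[p]) = (ξ i : ZMod p) ∧
        x i * z ^ (k i) = ((t : ℤ_[p]) ^ s) ^ (nn i)}
  set N := ∏ i, nn i
  have hN0 : N ≠ 0 := Finset.prod_ne_zero_iff.mpr fun i _ => Nat.one_le_iff_ne_zero.mp (hnn i)
  have hp1 : p - 1 ≠ 0 := Nat.sub_ne_zero_of_lt hpp.one_lt
  have hval : padicValNat p ((p - 1) * N) = padicValNat p N := by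
    rw [padicValNat.mul hp1 hN0,
      padicValNat.eq_zero_of_not_dvd (Nat.not_dvd_of_pos_of_lt (by omega) (by omega)), zero_add]
  have hXE : ∀ c ∈ closure X, ‖c - 1‖ ≤ (p : ℝ) ^ (-(n : ℤ)) := fun c hc => by
    have h : c ∈ closure E := closure_mono (fun z hz => hz.1) hc
    rwa [hdense] at h
  have hmul : ∀ z ∈ X, ∀ e ∈ E, z * e ^ ((p - 1) * N) ∈ X := by
    rintro z ⟨⟨d₀, hd₀, hz⟩, hzi⟩ e ⟨d, hd, rfl⟩
    refine ⟨⟨d₀ * d ^ ((p - 1) * N), D.mul_mem hd₀ (D.pow_mem hd _), ?_⟩, fun i => ?_⟩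
    · rw [hz]; push_cast; ring
    · obtain ⟨t, ht, htξ, hti⟩ := hzi i
      obtain ⟨b, hb⟩ : nn i ∣ N := Finset.dvd_prod_of_mem nn (Finset.mem_univ i)
      refine ⟨t * (d ^ (b * k i)) ^ (p - 1), D.mul_mem ht (D.pow_mem (D.pow_mem hd _) _), ?_, ?_⟩
      · have hone : PadicInt.toZMod (((d ^ (b * k i) : ℤ_[p]ˣ) : ℤ_[p]) ^ (p - 1)) = 1 := by
          rw [map_pow]
          exact ZMod.pow_card_sub_one_eq_one ((Units.isUnit _).map PadicInt.toZMod).ne_zero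
        rw [Units.val_mul, map_mul, htξ, Units.val_pow_eq_pow_val _ (p - 1), hone, mul_one]
      · rw [mul_pow, ← mul_assoc, hti, hb]; push_cast; ring
  obtain ⟨F, hF, hFX⟩ := PadicInt.exists_finset_eq_biUnion_cosets (C := closure X)
    isClosed_closure (r := n + padicValNat p N)
    (fun c hc => by
      have hlt : ‖c - 1‖ < 1 := (hXE c hc).trans_lt
        (zpow_lt_one_of_neg₀ (by exact_mod_cast hpp.one_lt) (by omega))
      rw [PadicInt.isUnit_iff, PadicInt.norm_eq_one_iff_not_dvd]
      rw [PadicInt.norm_lt_one_iff_dvd] at hlt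
      exact fun h => PadicInt.prime_p.not_dvd_one ((dvd_sub_right h).mp hlt))
    (fun c hc w hw => by
      rw [PadicInt.norm_le_pow_iff_pow_dvd, ← hval] at hw
      obtain ⟨u, hu, rfl⟩ :=
        PadicInt.exists_pow_eq_of_pow_dvd_sub_one hp hn (mul_ne_zero hp1 hN0) hw
      have huE : u ∈ closure E := by
        rw [hdense]
        exact (PadicInt.norm_le_pow_iff_pow_dvd _ _).mpr hu
      exact map_mem_closure₂ (f := fun a b : ℤ_[p] => a * b ^ ((p - 1) * N))
        (by fun_prop) hc huE hmul)
  exact ⟨F, fun c hc => hXE c (hF c hc), hFX⟩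
end
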